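/- For each N ≥ 1 let λ_N be an additive Haar (Lebesgue) measure on the real vector space of N×N complex Hermitian matrices, and define the Gaussian Dirac-ensemble expectation ⟨f⟩_N = (∫ f(H)·exp(−(N/2)·tr H² − (1/2)·(tr H)²) dλ_N(H)) / (∫ exp(−(N/2)·tr H² − (1/2)·(tr H)²) dλ_N(H)). Let D_H = H ⊗ I_N + I_N ⊗ Hᵀ and let ρ_D(x) = ∫_ℝ ρ_W(x−t)·ρ_W(t) dt. Then for every natural number m, lim_{N→∞} (1/N²)·⟨tr(D_H^m)⟩_N = ∫_ℝ x^m · ρ_D(x) dx; that is, the limiting spectral moments of the Gaussian Dirac ensemble are those of the self-convolution of the Wigner semicircle distribution. -/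

import Mathlib

open MeasureTheory Matrix Kronecker Complex Filter Real

noncomputable instance (N : ℕ) :
    MeasurableSpace (selfAdjoint (Matrix (Fin N) (Fin N) ℂ)) := borel _

instance (N : ℕ) : BorelSpace (selfAdjoint (Matrix (Fin N) (Fin N) ℂ)) := ⟨rfl⟩

/-- The Gaussian weight `exp(−(N/2)·tr H² − (1/2)·(tr H)²)` of the type (1,0)
Gaussian Dirac ensemble. -/
noncomputable def gaussWeight (N : ℕ) (H : selfAdjoint (Matrix (Fin N) (Fin N) ℂ)) : ℝ :=
  Real.exp (-((N : ℝ) / 2) * (Matrix.trace ((H : Matrix (Fin N) (Fin N) ℂ) ^ 2)).re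
    - (1 / 2) * ((Matrix.trace (H : Matrix (Fin N) (Fin N) ℂ)).re) ^ 2)

/-- The type (1,0) Dirac operator `D_H = H ⊗ I_N + I_N ⊗ Hᵀ`. -/
noncomputable def diracOp (N : ℕ) (H : selfAdjoint (Matrix (Fin N) (Fin N) ℂ)) :
    Matrix ((Fin N) × (Fin N)) ((Fin N) × (Fin N)) ℂ :=
  (H : Matrix (Fin N) (Fin N) ℂ) ⊗ₖ (1 : Matrix (Fin N) (Fin N) ℂ) +
    (1 : Matrix (Fin N) (Fin N) ℂ) ⊗ₖ (H : Matrix (Fin N) (Fin N) ℂ)ᵀ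

/-- The Wigner semicircle density `ρ_W(x) = (1/(2π))√(4−x²)` (note `Real.sqrt` of a
negative number is `0`, so this vanishes outside `[−2,2]`). -/
noncomputable def rhoW (x : ℝ) : ℝ := (1 / (2 * π)) * Real.sqrt (4 - x ^ 2)

/-- The self-convolution `ρ_D(x) = ∫_ℝ ρ_W(x−t) ρ_W(t) dt`. -/
noncomputable def rhoD (x : ℝ) : ℝ := ∫ t : ℝ, rhoW (x - t) * rhoW t

/-- The trace of the `k`-th power of the generic `n × n` matrix. -/
noncomputable def genericTracePow (n R : Type*) [Fintype n] [DecidableEq n] [CommRing R] (k : ℕ) :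
    MvPolynomial (n × n) R :=
  Matrix.trace (mvPolynomialX n n R ^ k)

section GenericMatrix

variable {n R : Type*} [Fintype n] [DecidableEq n] [CommRing R]

theorem genericTracePow_zero : genericTracePow n R 0 = (Fintype.card n : MvPolynomial (n × n) R) := by
  simp [genericTracePow]

theorem eval_genericTracePow (H : Matrix n n R) (k : ℕ) :
    MvPolynomial.eval (fun p => H p.1 p.2) (genericTracePow n R k) = Matrix.trace (H ^ k) := by
  rw [genericTracePow, AddMonoidHom.map_trace]
  conv_rhs => rw [← mvPolynomialX_mapMatrix_eval H, ← map_pow]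
  rfl

theorem pderiv_genericPow (i j : n) (k : ℕ) (a b : n) :
    MvPolynomial.pderiv (i, j) ((mvPolynomialX n n R ^ k) a b) =
      ∑ s ∈ Finset.range k,
        (mvPolynomialX n n R ^ s) a i * (mvPolynomialX n n R ^ (k - 1 - s)) j b := by
  induction k generalizing b with
  | zero =>
    rw [pow_zero, Matrix.one_apply]
    split_ifs <;> simp
  | succ k ih =>
    have key : ∀ c, MvPolynomial.pderiv (i, j)
        ((mvPolynomialX n n R ^ k) a c * mvPolynomialX n n R c b) =
        (mvPolynomialX n n R ^ k) a c * (if c = i ∧ b = j then 1 else 0) +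
        ∑ s ∈ Finset.range k, (mvPolynomialX n n R ^ s) a i *
          ((mvPolynomialX n n R ^ (k - 1 - s)) j c * mvPolynomialX n n R c b) := by
      intro c
      rw [Derivation.leibniz, ih, smul_eq_mul, smul_eq_mul, mvPolynomialX_apply,
        MvPolynomial.pderiv_X, Pi.single_apply, Finset.mul_sum]
      simp only [Prod.mk.injEq]
      congr 1
      exact Finset.sum_congr rfl fun s _ => by ring
    rw [pow_succ, Matrix.mul_apply, map_sum, Finset.sum_congr rfl fun c _ => key c,
      Finset.sum_add_distrib, Finset.sum_comm, Finset.sum_range_succ, add_comm]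
    congr 1
    · refine Finset.sum_congr rfl fun s hs => ?_
      rw [← Finset.mul_sum, ← Matrix.mul_apply, ← pow_succ]
      have : k - 1 - s + 1 = k + 1 - 1 - s := by have := Finset.mem_range.1 hs; omega
      rw [this]
    · have : k + 1 - 1 - k = 0 := by omega
      rw [this, pow_zero, Matrix.one_apply]
      by_cases hb : b = j
      · simp [hb]
      · simp [hb, Ne.symm hb]

theorem pderiv_genericTracePow (i j : n) (k : ℕ) :
    MvPolynomial.pderiv (i, j) (genericTracePow n R k) =
      k * (mvPolynomialX n n R ^ (k - 1)) j i := by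
  have key : ∀ s ∈ Finset.range k, ∑ a, (mvPolynomialX n n R ^ s) a i *
      (mvPolynomialX n n R ^ (k - 1 - s)) j a = (mvPolynomialX n n R ^ (k - 1)) j i := by
    intro s hs
    simp_rw [mul_comm ((mvPolynomialX n n R ^ s) _ i)]
    have : k - 1 - s + s = k - 1 := by have := Finset.mem_range.1 hs; omega
    rw [← Matrix.mul_apply, ← pow_add, this]
  simp only [genericTracePow, Matrix.trace, Matrix.diag_apply, map_sum, pderiv_genericPow]
  rw [Finset.sum_comm, Finset.sum_congr rfl key]
  simp

theorem sum_pderiv_genericPow (k : ℕ) :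
    ∑ i, ∑ j, MvPolynomial.pderiv (i, j) ((mvPolynomialX n n R ^ k) i j) =
      ∑ s ∈ Finset.range k, genericTracePow n R s * genericTracePow n R (k - 1 - s) := by
  simp only [pderiv_genericPow, genericTracePow, Matrix.trace, Matrix.diag_apply,
    Finset.sum_mul_sum]
  simp_rw [Finset.sum_comm (t := Finset.range k)]

/-- The product of the generic traces `tr X ^ l` for `l` in a multiset. -/
noncomputable def genericTraceProd (n R : Type*) [Fintype n] [DecidableEq n] [CommRing R]
    (L : Multiset ℕ) : MvPolynomial (n × n) R :=
  (L.map (genericTracePow n R)).prod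

theorem genericTraceProd_cons (k : ℕ) (L : Multiset ℕ) :
    genericTraceProd n R (k ::ₘ L) = genericTracePow n R k * genericTraceProd n R L := by
  simp [genericTraceProd]

theorem pderiv_genericTraceProd (i j : n) (L : Multiset ℕ) :
    MvPolynomial.pderiv (i, j) (genericTraceProd n R L) =
      (L.map fun l => l * (mvPolynomialX n n R ^ (l - 1)) j i *
        genericTraceProd n R (L.erase l)).sum := by
  induction L using Multiset.induction_on with
  | empty => simp [genericTraceProd]
  | cons a L ih =>
    rw [genericTraceProd_cons, Derivation.leibniz, ih, pderiv_genericTracePow, Multiset.map_cons,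
      Multiset.sum_cons, Multiset.erase_cons_head, smul_eq_mul, smul_eq_mul, add_comm,
      ← Multiset.sum_map_mul_left]
    congr 1
    · ring
    · refine congrArg Multiset.sum (Multiset.map_congr rfl fun l hl => ?_)
      rw [Multiset.erase_cons_tail_of_mem hl, genericTraceProd_cons]
      ring

theorem sum_genericPow_mul_pderiv_genericTraceProd (k : ℕ) (L : Multiset ℕ) :
    ∑ i, ∑ j, (mvPolynomialX n n R ^ k) i j *
        MvPolynomial.pderiv (i, j) (genericTraceProd n R L) =
      (L.map fun l => l * genericTraceProd n R ((k + (l - 1)) ::ₘ L.erase l)).sum := by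
  simp_rw [pderiv_genericTraceProd, ← Multiset.sum_map_mul_left, ← Multiset.sum_map_sum]
  refine congrArg Multiset.sum (Multiset.map_congr rfl fun l _ => ?_)
  have key : genericTracePow n R (k + (l - 1)) =
      ∑ i, ∑ j, (mvPolynomialX n n R ^ k) i j * (mvPolynomialX n n R ^ (l - 1)) j i := by
    simp [genericTracePow, pow_add, Matrix.trace, Matrix.mul_apply]
  rw [genericTraceProd_cons, key]
  simp_rw [Finset.sum_mul, Finset.mul_sum]
  exact Finset.sum_congr rfl fun i _ => Finset.sum_congr rfl fun j _ => by ring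

end GenericMatrix

section LoopEquations

/-- A linear functional on polynomials in the matrix entries satisfying the integration by parts
formula of the weight `exp (-(N / 2) tr H ^ 2 - (1 / 2) (tr H) ^ 2)` satisfies the loop equations. -/
theorem loop_equation {n R : Type*} [Fintype n] [DecidableEq n] [CommRing R]
    (Φ : MvPolynomial (n × n) R →ₗ[R] R)
    (hΦ : ∀ i j p, Φ (MvPolynomial.pderiv (i, j) p) =
      Φ (p * (Fintype.card n * mvPolynomialX n n R j i +
        (1 : Matrix n n (MvPolynomial (n × n) R)) i j * genericTracePow n R 1)))
    (k : ℕ) (L : Multiset ℕ) :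
    Fintype.card n * Φ (genericTraceProd n R ((k + 1) ::ₘ L)) +
        Φ (genericTraceProd n R (1 ::ₘ k ::ₘ L)) =
      ∑ s ∈ Finset.range k, Φ (genericTraceProd n R (s ::ₘ (k - 1 - s) ::ₘ L)) +
        (L.map fun l => l * Φ (genericTraceProd n R ((k + (l - 1)) ::ₘ L.erase l))).sum := by
  have hnat : ∀ (m : ℕ) (p : MvPolynomial (n × n) R), Φ (m * p) = m * Φ p := fun m p => by
    rw [← nsmul_eq_mul, map_nsmul, nsmul_eq_mul]
  have lhs : ∑ i, ∑ j, (mvPolynomialX n n R ^ k) i j * genericTraceProd n R L *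
      (Fintype.card n * mvPolynomialX n n R j i +
        (1 : Matrix n n (MvPolynomial (n × n) R)) i j * genericTracePow n R 1) =
      Fintype.card n * genericTraceProd n R ((k + 1) ::ₘ L) +
        genericTraceProd n R (1 ::ₘ k ::ₘ L) := by
    have h1 : genericTracePow n R (k + 1) =
        ∑ i, ∑ j, (mvPolynomialX n n R ^ k) i j * mvPolynomialX n n R j i := by
      simp [genericTracePow, pow_succ, Matrix.trace, Matrix.mul_apply]
    have h2 : genericTracePow n R k = ∑ i, ∑ j, (mvPolynomialX n n R ^ k) i j *
        (1 : Matrix n n (MvPolynomial (n × n) R)) i j := by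
      simp [genericTracePow, Matrix.trace, Matrix.one_apply]
    rw [genericTraceProd_cons, genericTraceProd_cons, genericTraceProd_cons, h1, h2]
    rw [← mul_assoc, ← mul_assoc, Finset.mul_sum, Finset.mul_sum, Finset.sum_mul, Finset.sum_mul,
      ← Finset.sum_add_distrib]
    refine Finset.sum_congr rfl fun i _ => ?_
    rw [Finset.mul_sum, Finset.mul_sum, Finset.sum_mul, Finset.sum_mul, ← Finset.sum_add_distrib]
    exact Finset.sum_congr rfl fun j _ => by ring
  have rhs : ∑ i, ∑ j, MvPolynomial.pderiv (i, j)
      ((mvPolynomialX n n R ^ k) i j * genericTraceProd n R L) =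
      ∑ s ∈ Finset.range k, genericTraceProd n R (s ::ₘ (k - 1 - s) ::ₘ L) +
        (L.map fun l => l * genericTraceProd n R ((k + (l - 1)) ::ₘ L.erase l)).sum := by
    have hcons : ∀ s ∈ Finset.range k, genericTraceProd n R (s ::ₘ (k - 1 - s) ::ₘ L) =
        genericTracePow n R s * genericTracePow n R (k - 1 - s) * genericTraceProd n R L :=
      fun s _ => by rw [genericTraceProd_cons, genericTraceProd_cons, mul_assoc]
    rw [Finset.sum_congr rfl hcons, ← Finset.sum_mul, ← sum_pderiv_genericPow,
      ← sum_genericPow_mul_pderiv_genericTraceProd, add_comm]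
    rw [Finset.sum_mul, ← Finset.sum_add_distrib]
    refine Finset.sum_congr rfl fun i _ => ?_
    rw [Finset.sum_mul, ← Finset.sum_add_distrib]
    refine Finset.sum_congr rfl fun j _ => ?_
    rw [Derivation.leibniz, smul_eq_mul, smul_eq_mul]
    ring
  have hsum : Φ (∑ i, ∑ j, (mvPolynomialX n n R ^ k) i j * genericTraceProd n R L *
      (Fintype.card n * mvPolynomialX n n R j i +
        (1 : Matrix n n (MvPolynomial (n × n) R)) i j * genericTracePow n R 1)) =
      Φ (∑ i, ∑ j, MvPolynomial.pderiv (i, j)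
        ((mvPolynomialX n n R ^ k) i j * genericTraceProd n R L)) := by
    rw [map_sum, map_sum]
    refine Finset.sum_congr rfl fun i _ => ?_
    rw [map_sum, map_sum]
    exact Finset.sum_congr rfl fun j _ => (hΦ i j _).symm
  rw [← hnat, ← map_add, ← lhs, hsum, rhs, map_add, map_sum, map_multiset_sum, Multiset.map_map]
  simp only [Function.comp_def, hnat]

/-- Normalised solutions of the loop equations converge to products of the planar moments. -/
theorem tendsto_of_loop_equation (c : ℕ → ℂ) (hc0 : c 0 = 1)
    (hc : ∀ k, c (k + 1) = ∑ s ∈ Finset.range k, c s * c (k - 1 - s))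
    (E : ℕ → Multiset ℕ → ℂ)
    (hnil : ∀ᶠ N in atTop, E N 0 = 1)
    (hzero : ∀ᶠ N in atTop, ∀ L, E N (0 ::ₘ L) = E N L)
    (hloop : ∀ᶠ N in atTop, ∀ k L, E N ((k + 1) ::ₘ L) + E N (1 ::ₘ k ::ₘ L) =
      ∑ s ∈ Finset.range k, E N (s ::ₘ (k - 1 - s) ::ₘ L) +
        ((N : ℂ) ^ 2)⁻¹ * (L.map fun l : ℕ => (l : ℂ) * E N ((k + (l - 1)) ::ₘ L.erase l)).sum)
    (L : Multiset ℕ) : Tendsto (fun N => E N L) atTop (nhds (L.map c).prod) := by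
  induction hm : L.sum + L.card using Nat.strong_induction_on generalizing L with
  | _ m ih =>
  have hinv : Tendsto (fun N : ℕ => ((N : ℂ) ^ 2)⁻¹) atTop (nhds 0) := by
    have := (tendsto_inv_atTop_nhds_zero_nat (𝕜 := ℂ)).pow 2
    simpa using this
  have hrest : ∀ (k : ℕ) (M : Multiset ℕ), k + M.sum + M.card ≤ m → Tendsto (fun N : ℕ =>
      ((N : ℂ) ^ 2)⁻¹ * (M.map fun l : ℕ => (l : ℂ) * E N ((k + (l - 1)) ::ₘ M.erase l)).sum)
      atTop (nhds 0) := by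
    intro k M hM
    rw [← zero_mul (M.map fun l : ℕ => (l : ℂ) * (((k + (l - 1)) ::ₘ M.erase l).map c).prod).sum]
    refine hinv.mul (tendsto_multiset_sum M fun l hl => ?_)
    rcases Nat.eq_zero_or_pos l with rfl | hpos
    · simp
    refine (ih _ ?_ _ rfl).const_mul _
    have h1 := Multiset.sum_erase hl
    have h2 := Multiset.card_erase_add_one hl
    rw [Multiset.sum_cons, Multiset.card_cons]
    omega
  induction L using Multiset.induction_on with
  | empty => exact tendsto_const_nhds.congr' (by filter_upwards [hnil] with N h; simp [h])
  | cons a L _ =>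
  rw [Multiset.sum_cons, Multiset.card_cons] at hm
  rcases a with - | k
  · refine (ih (L.sum + L.card) (by omega) L rfl).congr' ?_ |>.trans ?_
    · filter_upwards [hzero] with N h using (h L).symm
    · simp [hc0]
  · have hone : Tendsto (fun N => E N (1 ::ₘ k ::ₘ L)) atTop (nhds 0) := by
      have := (hrest 0 (k ::ₘ L) (by
        rw [Multiset.sum_cons, Multiset.card_cons]; omega)).const_mul (1 / 2)
      rw [mul_zero] at this
      refine this.congr' ?_
      filter_upwards [hloop, hzero] with N h h0
      have := h 0 (k ::ₘ L)
      rw [Multiset.cons_swap 1 0, h0] at this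
      simp only [zero_add, Finset.range_zero, Finset.sum_empty] at this ⊢
      rw [← this]
      ring
    have hsum : Tendsto (fun N => ∑ s ∈ Finset.range k, E N (s ::ₘ (k - 1 - s) ::ₘ L)) atTop
        (nhds (∑ s ∈ Finset.range k, ((s ::ₘ (k - 1 - s) ::ₘ L).map c).prod)) := by
      refine tendsto_finsetSum _ fun s hs => ih _ ?_ _ rfl
      have := Finset.mem_range.1 hs
      simp only [Multiset.sum_cons, Multiset.card_cons]
      omega
    have := (hsum.add (hrest k L (by omega))).sub hone
    have hlim : ∑ s ∈ Finset.range k, ((s ::ₘ (k - 1 - s) ::ₘ L).map c).prod + 0 - 0 =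
        (((k + 1) ::ₘ L).map c).prod := by
      simp [hc, Finset.sum_mul, mul_assoc]
    rw [hlim] at this
    refine this.congr' ?_
    filter_upwards [hloop] with N h
    rw [← h k L]
    ring

end LoopEquations

section Semicircle

/-- The moments of the semicircle law: Catalan numbers in even degree, zero in odd degree. -/
noncomputable def semicircleMoment (k : ℕ) : ℝ := if Even k then catalan (k / 2) else 0

theorem semicircleMoment_succ (k : ℕ) : semicircleMoment (k + 1) =
    ∑ s ∈ Finset.range k, semicircleMoment s * semicircleMoment (k - 1 - s) := by
  have hodd : ∀ j, ¬ Even j → semicircleMoment j = 0 := fun j hj => if_neg hj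
  rcases Nat.even_or_odd' k with ⟨r, rfl | rfl⟩
  · rw [hodd _ (by simp [parity_simps]), eq_comm]
    refine Finset.sum_eq_zero fun s hs => ?_
    have hs := Finset.mem_range.1 hs
    by_cases h : Even s
    · rw [hodd (2 * r - 1 - s), mul_zero]
      obtain ⟨a, rfl⟩ := h
      rintro ⟨b, hb⟩
      omega
    · rw [hodd s h, zero_mul]
  · have hsplit : ∀ (f : ℕ → ℝ) (r : ℕ), (∀ i, f (2 * i + 1) = 0) →
        ∑ s ∈ Finset.range (2 * r + 1), f s = ∑ i ∈ Finset.range (r + 1), f (2 * i) := by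
      intro f r hf
      induction r with
      | zero => simp
      | succ r ih =>
        rw [Finset.sum_range_succ _ (r + 1), ← ih, mul_add_one, Finset.sum_range_succ,
          Finset.sum_range_succ, hf, add_zero]
    have heven : ∀ i, semicircleMoment (2 * i) = catalan i := fun i => by simp [semicircleMoment]
    rw [hsplit _ r fun i => by rw [hodd (2 * i + 1) (by simp [parity_simps]), zero_mul],
      show 2 * r + 1 + 1 = 2 * (r + 1) by ring, heven, catalan_succ',
      Finset.Nat.sum_antidiagonal_eq_sum_range_succ_mk]
    push_cast
    refine Finset.sum_congr rfl fun i _ => ?_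
    rw [show 2 * r - 2 * i = 2 * (r - i) by omega, heven, heven]

theorem continuous_rhoW : Continuous rhoW := by
  unfold rhoW
  fun_prop

theorem rhoW_eq_zero {x : ℝ} (hx : x ∉ Set.Icc (-2) 2) : rhoW x = 0 := by
  have : 4 - x ^ 2 ≤ 0 := by
    by_contra! h
    exact hx ⟨by nlinarith, by nlinarith⟩
  rw [rhoW, Real.sqrt_eq_zero_of_nonpos this, mul_zero]

theorem hasCompactSupport_rhoW : HasCompactSupport rhoW :=
  HasCompactSupport.intro isCompact_Icc fun _ hx => rhoW_eq_zero hx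

theorem integrable_pow_mul_rhoW (k : ℕ) : Integrable fun x => x ^ k * rhoW x :=
  ((continuous_pow k).mul continuous_rhoW).integrable_of_hasCompactSupport
    hasCompactSupport_rhoW.mul_left

theorem integral_mul_rhoW_eq_intervalIntegral (f : ℝ → ℝ) :
    ∫ x, f x * rhoW x = ∫ x in (-2)..2, f x * rhoW x := by
  rw [intervalIntegral.integral_of_le (by norm_num), ← integral_Icc_eq_integral_Ioc,
    setIntegral_eq_integral_of_forall_compl_eq_zero]
  intro x hx
  rw [rhoW_eq_zero hx, mul_zero]

theorem integral_pow_mul_rhoW_add_two (k : ℕ) :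
    (k + 4) * ∫ x, x ^ (k + 2) * rhoW x = 4 * (k + 1) * ∫ x, x ^ k * rhoW x := by
  have hderiv : ∀ x ∈ Set.Ioo (-2 : ℝ) 2, HasDerivAt
      (fun x => x ^ (k + 1) * (4 - x ^ 2) * rhoW x)
      (4 * (k + 1) * (x ^ k * rhoW x) - (k + 4) * (x ^ (k + 2) * rhoW x)) x := by
    intro x hx
    have hpos : 0 < 4 - x ^ 2 := by nlinarith [hx.1, hx.2]
    have h1 : HasDerivAt (fun x : ℝ => 4 - x ^ 2) (-(2 * x)) x := by
      simpa using (hasDerivAt_pow 2 x).const_sub 4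
    have h2 := ((hasDerivAt_pow (k + 1) x).mul h1).mul
      ((h1.sqrt hpos.ne').const_mul (1 / (2 * π)))
    refine h2.congr_deriv ?_
    have hs : 0 < √(4 - x ^ 2) := Real.sqrt_pos.2 hpos
    have hsq : √(4 - x ^ 2) ^ 2 = 4 - x ^ 2 := Real.sq_sqrt hpos.le
    simp only [rhoW, Nat.add_sub_cancel, Nat.cast_add, Nat.cast_one, Pi.mul_apply]
    set s := √(4 - x ^ 2)
    have hx2 : x ^ 2 = 4 - s ^ 2 := by linarith
    field_simp
    ring_nf
    linear_combination (x ^ k * x ^ 2) * hx2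
  have hint : ∀ c : ℝ, ∀ j : ℕ,
      IntervalIntegrable (fun x => c * (x ^ j * rhoW x)) volume (-2) 2 := fun c j =>
    (continuous_const.mul ((continuous_pow j).mul continuous_rhoW)).intervalIntegrable _ _
  have hcont : Continuous fun x => x ^ (k + 1) * (4 - x ^ 2) * rhoW x := by
    have := continuous_rhoW
    fun_prop
  have h := intervalIntegral.integral_eq_sub_of_hasDerivAt_of_le (by norm_num)
    hcont.continuousOn hderiv ((hint _ _).sub (hint _ _))
  rw [intervalIntegral.integral_sub (hint _ _) (hint _ _), intervalIntegral.integral_const_mul,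
    intervalIntegral.integral_const_mul, ← integral_mul_rhoW_eq_intervalIntegral,
    ← integral_mul_rhoW_eq_intervalIntegral] at h
  norm_num at h
  linarith

theorem integral_rhoW : ∫ x, rhoW x = 1 := by
  have h := integral_mul_rhoW_eq_intervalIntegral fun _ => 1
  simp only [one_mul] at h
  have hscale : ∀ u, rhoW (2 * u) = 1 / π * √(1 - u ^ 2) := fun u => by
    rw [rhoW, show 4 - (2 * u) ^ 2 = 2 ^ 2 * (1 - u ^ 2) by ring,
      Real.sqrt_mul (by norm_num), Real.sqrt_sq (by norm_num)]
    ring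
  have h2 := intervalIntegral.integral_comp_mul_left (a := -1) (b := 1) rhoW (two_ne_zero (α := ℝ))
  simp_rw [hscale] at h2
  rw [intervalIntegral.integral_const_mul, integral_sqrt_one_sub_sq, mul_neg_one, mul_one] at h2
  rw [h]
  have := Real.pi_ne_zero
  field_simp at h2
  rw [smul_eq_mul] at h2
  linarith

theorem integral_id_mul_rhoW : ∫ x, x * rhoW x = 0 := by
  have h := integral_neg_eq_self (fun x => x * rhoW x) volume
  have : ∀ x, -x * rhoW (-x) = -(x * rhoW x) := fun x => by simp [rhoW]
  simp only [this, integral_neg] at h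
  linarith

theorem integral_pow_mul_rhoW (k : ℕ) : ∫ x, x ^ k * rhoW x = semicircleMoment k := by
  induction k using Nat.twoStepInduction with
  | zero => simp [integral_rhoW, semicircleMoment]
  | one => simp [integral_id_mul_rhoW, semicircleMoment]
  | more k ih _ =>
    have h := integral_pow_mul_rhoW_add_two k
    rw [ih] at h
    have hk : (k + 4 : ℝ) ≠ 0 := by positivity
    apply mul_left_cancel₀ hk
    rw [h]
    rcases Nat.even_or_odd' k with ⟨r, rfl | rfl⟩
    · have e1 : (2 * r + 2) / 2 = r + 1 := by omega
      have e2 : 2 * r / 2 = r := by omega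
      have e3 : Even (2 * r + 2) := ⟨r + 1, by omega⟩
      simp only [semicircleMoment, e1, e2, e3, even_two_mul, if_true]
      have h1 := Nat.succ_mul_centralBinom_succ r
      rw [← succ_mul_catalan_eq_centralBinom, ← succ_mul_catalan_eq_centralBinom] at h1
      have h2 : ((r + 1 : ℕ) : ℝ) * ((r + 1 + 1 : ℕ) * catalan (r + 1)) =
        2 * (2 * r + 1) * ((r + 1 : ℕ) * catalan r) := by exact_mod_cast h1
      have h3 : ((r + 1 : ℕ) : ℝ) ≠ 0 := by positivity
      apply mul_left_cancel₀ h3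
      push_cast at h2 ⊢
      linarith
    · simp [semicircleMoment, parity_simps]

theorem integral_pow_mul_rhoD (m : ℕ) : ∫ x, x ^ m * rhoD x =
    ∑ k ∈ Finset.range (m + 1), semicircleMoment k * semicircleMoment (m - k) * m.choose k := by
  have hswap : ∫ x, ∫ t, x ^ m * (rhoW (x - t) * rhoW t) =
      ∫ t, ∫ x, x ^ m * (rhoW (x - t) * rhoW t) := by
    refine integral_integral_swap_of_hasCompactSupport ?_ ?_
    · have := continuous_rhoW
      simp only [Function.uncurry_def]
      fun_prop
    · refine HasCompactSupport.intro (K := Set.Icc (-4) 4 ×ˢ Set.Icc (-2) 2)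
        (isCompact_Icc.prod isCompact_Icc) fun ⟨x, t⟩ hx => ?_
      simp only [Function.uncurry_apply_pair]
      by_cases ht : t ∈ Set.Icc (-2 : ℝ) 2
      · have : x - t ∉ Set.Icc (-2 : ℝ) 2 := fun h =>
          hx ⟨⟨by linarith [h.1, ht.1], by linarith [h.2, ht.2]⟩, ht⟩
        simp [rhoW_eq_zero this]
      · simp [rhoW_eq_zero ht]
  have hinner : ∀ t, ∫ x, x ^ m * (rhoW (x - t) * rhoW t) =
      ∑ k ∈ Finset.range (m + 1),
        semicircleMoment k * (t ^ (m - k) * rhoW t) * m.choose k := by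
    intro t
    rw [← integral_add_right_eq_self _ t]
    have : ∀ x, (x + t) ^ m * (rhoW (x + t - t) * rhoW t) = ∑ k ∈ Finset.range (m + 1),
        (x ^ k * rhoW x) * (t ^ (m - k) * rhoW t * m.choose k) := fun x => by
      rw [add_pow, add_sub_cancel_right, Finset.sum_mul]
      exact Finset.sum_congr rfl fun k _ => by ring
    simp_rw [this]
    rw [integral_finsetSum _ fun k _ => (integrable_pow_mul_rhoW k).mul_const _]
    refine Finset.sum_congr rfl fun k _ => ?_
    rw [integral_mul_const, integral_pow_mul_rhoW, ← mul_assoc]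
  simp_rw [rhoD, ← integral_const_mul]
  rw [hswap]
  simp_rw [hinner]
  rw [integral_finsetSum _ fun k _ => ((integrable_pow_mul_rhoW (m - k)).const_mul _).mul_const _]
  refine Finset.sum_congr rfl fun k _ => ?_
  rw [integral_mul_const, integral_const_mul, integral_pow_mul_rhoW]

end Semicircle

section GaussianIntegral

attribute [local instance] Matrix.normedAddCommGroup Matrix.normedSpace

noncomputable local instance (N : ℕ) : NormedSpace ℝ (selfAdjoint (Matrix (Fin N) (Fin N) ℂ)) where
  norm_smul_le a H := norm_smul_le a (H : Matrix (Fin N) (Fin N) ℂ)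

local instance (N : ℕ) : FiniteDimensional ℝ (selfAdjoint (Matrix (Fin N) (Fin N) ℂ)) :=
  Module.Finite.of_injective
    (selfAdjoint.submodule ℝ (Matrix (Fin N) (Fin N) ℂ)).subtype Subtype.val_injective

local instance (N : ℕ) : @BorelSpace (selfAdjoint (Matrix (Fin N) (Fin N) ℂ))
    (PseudoMetricSpace.toUniformSpace.toTopologicalSpace) _ :=
  ⟨rfl⟩

local instance (N : ℕ) (μ : Measure (selfAdjoint (Matrix (Fin N) (Fin N) ℂ)))
    [h : μ.IsAddHaarMeasure] : @Measure.IsAddHaarMeasure _ _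
      (PseudoMetricSpace.toUniformSpace.toTopologicalSpace) _ μ :=
  h

variable {N : ℕ}

/-- Evaluation of a polynomial in the matrix entries at a Hermitian matrix. -/
noncomputable def evalHermitian (p : MvPolynomial (Fin N × Fin N) ℂ)
    (H : selfAdjoint (Matrix (Fin N) (Fin N) ℂ)) : ℂ :=
  MvPolynomial.eval (fun ij => (H : Matrix (Fin N) (Fin N) ℂ) ij.1 ij.2) p

theorem evalHermitian_genericTracePow (k : ℕ) (H : selfAdjoint (Matrix (Fin N) (Fin N) ℂ)) :
    evalHermitian (genericTracePow (Fin N) ℂ k) H =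
      Matrix.trace ((H : Matrix (Fin N) (Fin N) ℂ) ^ k) :=
  eval_genericTracePow _ k

theorem continuous_evalHermitian (p : MvPolynomial (Fin N × Fin N) ℂ) :
    Continuous (evalHermitian p) :=
  p.continuous_eval.comp
    (continuous_pi fun ij => continuous_subtype_val.matrix_elem ij.1 ij.2)

theorem exists_norm_evalHermitian_le (p : MvPolynomial (Fin N × Fin N) ℂ) :
    ∃ (C : ℝ) (k : ℕ), 0 ≤ C ∧ ∀ H, ‖evalHermitian p H‖ ≤ C * (1 + ‖H‖) ^ k := by
  induction p using MvPolynomial.induction_on with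
  | C a => exact ⟨‖a‖, 0, norm_nonneg a, fun H => by simp [evalHermitian]⟩
  | add p q hp hq =>
    obtain ⟨C, k, hC, h⟩ := hp
    obtain ⟨C', k', hC', h'⟩ := hq
    refine ⟨C + C', k + k', add_nonneg hC hC', fun H => ?_⟩
    have h1 : 1 ≤ 1 + ‖H‖ := le_add_of_nonneg_right (norm_nonneg H)
    calc ‖evalHermitian (p + q) H‖ ≤ ‖evalHermitian p H‖ + ‖evalHermitian q H‖ := by
          simp only [evalHermitian, map_add]
          exact norm_add_le _ _
      _ ≤ C * (1 + ‖H‖) ^ (k + k') + C' * (1 + ‖H‖) ^ (k + k') := by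
          refine add_le_add ((h H).trans ?_) ((h' H).trans ?_) <;> gcongr <;> omega
      _ = _ := by ring
  | mul_X p ij hp =>
    obtain ⟨C, k, hC, h⟩ := hp
    refine ⟨C, k + 1, hC, fun H => ?_⟩
    have hentry : ‖(H : Matrix (Fin N) (Fin N) ℂ) ij.1 ij.2‖ ≤ 1 + ‖H‖ :=
      (Matrix.norm_entry_le_entrywise_sup_norm (H : Matrix (Fin N) (Fin N) ℂ)).trans
        (le_add_of_nonneg_left zero_le_one)
    rw [pow_succ, ← mul_assoc]
    simp only [evalHermitian, map_mul, MvPolynomial.eval_X, norm_mul]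
    exact mul_le_mul (h H) hentry (norm_nonneg _) (by positivity)

theorem trace_sq_eq_sum_norm_sq (H : selfAdjoint (Matrix (Fin N) (Fin N) ℂ)) :
    Matrix.trace ((H : Matrix (Fin N) (Fin N) ℂ) ^ 2) =
      ((∑ i, ∑ j, ‖(H : Matrix (Fin N) (Fin N) ℂ) i j‖ ^ 2 : ℝ) : ℂ) := by
  have hH : ∀ i j, (H : Matrix (Fin N) (Fin N) ℂ) j i =
      star ((H : Matrix (Fin N) (Fin N) ℂ) i j) := fun i j =>
    (congrFun (congrFun H.2 j) i).symm
  simp only [pow_two, Matrix.trace, Matrix.diag_apply, Matrix.mul_apply, Complex.ofReal_sum]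
  refine Finset.sum_congr rfl fun i _ => Finset.sum_congr rfl fun j _ => ?_
  rw [hH i j, ← pow_two, ← Complex.normSq_eq_norm_sq, ← Complex.mul_conj]
  rfl

theorem norm_sq_le_trace_sq (H : selfAdjoint (Matrix (Fin N) (Fin N) ℂ)) :
    ‖H‖ ^ 2 ≤ (Matrix.trace ((H : Matrix (Fin N) (Fin N) ℂ) ^ 2)).re := by
  rw [trace_sq_eq_sum_norm_sq, Complex.ofReal_re]
  set S := ∑ i, ∑ j, ‖(H : Matrix (Fin N) (Fin N) ℂ) i j‖ ^ 2
  have hS : 0 ≤ S := by positivity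
  rw [← Real.le_sqrt (norm_nonneg H) hS]
  refine (Matrix.norm_le_iff (Real.sqrt_nonneg S)).2 fun i j => Real.le_sqrt_of_sq_le ?_
  refine (Finset.single_le_sum (f := fun j => ‖(H : Matrix (Fin N) (Fin N) ℂ) i j‖ ^ 2)
    (fun _ _ => by positivity) (Finset.mem_univ j)).trans ?_
  exact Finset.single_le_sum (f := fun i => ∑ j, ‖(H : Matrix (Fin N) (Fin N) ℂ) i j‖ ^ 2)
    (fun _ _ => by positivity) (Finset.mem_univ i)

theorem gaussWeight_le (hN : 1 ≤ N) (H : selfAdjoint (Matrix (Fin N) (Fin N) ℂ)) :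
    gaussWeight N H ≤ Real.exp (-(1 / 2) * ‖H‖ ^ 2) := by
  refine Real.exp_le_exp.2 ?_
  have h1 := norm_sq_le_trace_sq H
  have h2 : (1 : ℝ) ≤ N := by exact_mod_cast hN
  have h3 : 0 ≤ ‖H‖ ^ 2 := by positivity
  nlinarith [sq_nonneg (Matrix.trace (H : Matrix (Fin N) (Fin N) ℂ)).re]

theorem pow_mul_exp_le {r : ℝ} (hr : 0 ≤ r) (k : ℕ) :
    (1 + r) ^ k * Real.exp (-(1 / 2) * r ^ 2) ≤ k.factorial * Real.exp (3 / 2) := by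
  have h1 := Real.pow_div_factorial_le_exp (x := 1 + r) (by positivity) k
  rw [div_le_iff₀ (by positivity)] at h1
  calc (1 + r) ^ k * Real.exp (-(1 / 2) * r ^ 2)
      ≤ Real.exp (1 + r) * k.factorial * Real.exp (-(1 / 2) * r ^ 2) := by gcongr
    _ = k.factorial * Real.exp (1 + r + -(1 / 2) * r ^ 2) := by rw [Real.exp_add (1 + r)]; ring
    _ ≤ k.factorial * Real.exp (3 / 2) := by
      gcongr
      nlinarith [sq_nonneg (r - 1)]

theorem continuous_gaussWeight : Continuous (gaussWeight N) := by
  have h := fun k : ℕ => Complex.continuous_re.comp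
    (continuous_evalHermitian (genericTracePow (Fin N) ℂ k))
  simp only [Function.comp_def, evalHermitian_genericTracePow] at h
  have h1 := h 1
  have h2 := h 2
  simp only [pow_one] at h1
  unfold gaussWeight
  fun_prop

variable (μ : Measure (selfAdjoint (Matrix (Fin N) (Fin N) ℂ))) [μ.IsAddHaarMeasure]

theorem integrable_evalHermitian_mul_gaussWeight (hN : 1 ≤ N)
    (p : MvPolynomial (Fin N × Fin N) ℂ) :
    Integrable (fun H => evalHermitian p H * (gaussWeight N H : ℂ)) μ := by
  obtain ⟨C, k, hC, h⟩ := exists_norm_evalHermitian_le p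
  set d := Module.finrank ℝ (selfAdjoint (Matrix (Fin N) (Fin N) ℂ)) + 1 with hd
  have hint : Integrable (fun H => C * ((k + d).factorial * Real.exp (3 / 2)) *
      (1 + ‖H‖) ^ (-(d : ℝ))) μ := (integrable_one_add_norm (by rw [hd]; simp)).const_mul _
  refine hint.mono' ?_ (ae_of_all _ fun H => ?_)
  · exact ((continuous_evalHermitian p).mul
      (Complex.continuous_ofReal.comp continuous_gaussWeight)).aestronglyMeasurable
  · have hpos : 0 < (1 + ‖H‖) := by positivity
    rw [Real.rpow_neg hpos.le, Real.rpow_natCast, norm_mul, Complex.norm_real,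
      Real.norm_of_nonneg (r := gaussWeight N H) (Real.exp_nonneg _), ← div_eq_mul_inv, le_div_iff₀ (by positivity)]
    calc ‖evalHermitian p H‖ * gaussWeight N H * (1 + ‖H‖) ^ d
        ≤ C * (1 + ‖H‖) ^ k * Real.exp (-(1 / 2) * ‖H‖ ^ 2) * (1 + ‖H‖) ^ d := by
          have := h H
          have := gaussWeight_le hN H
          have : 0 ≤ gaussWeight N H := Real.exp_nonneg _
          gcongr
      _ = C * ((1 + ‖H‖) ^ (k + d) * Real.exp (-(1 / 2) * ‖H‖ ^ 2)) := by ring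
      _ ≤ _ := by
          exact mul_le_mul_of_nonneg_left (pow_mul_exp_le (norm_nonneg H) _) hC

/-- The linear functional `p ↦ ∫ p(H) exp (-(N / 2) tr H ^ 2 - (1 / 2) (tr H) ^ 2)` on polynomials
in the matrix entries. -/
noncomputable def gaussFunctional (hN : 1 ≤ N) : MvPolynomial (Fin N × Fin N) ℂ →ₗ[ℂ] ℂ where
  toFun p := ∫ H, evalHermitian p H * (gaussWeight N H : ℂ) ∂μ
  map_add' p q := by
    rw [← integral_add (integrable_evalHermitian_mul_gaussWeight μ hN p)
      (integrable_evalHermitian_mul_gaussWeight μ hN q)]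
    simp only [evalHermitian, map_add, add_mul]
  map_smul' a p := by
    rw [RingHom.id_apply, smul_eq_mul, ← integral_const_mul]
    simp only [evalHermitian, MvPolynomial.smul_eval, mul_assoc]

theorem gaussFunctional_one (hN : 1 ≤ N) :
    gaussFunctional μ hN 1 = ((∫ H, gaussWeight N H ∂μ : ℝ) : ℂ) := by
  rw [← integral_complex_ofReal]
  simp [gaussFunctional, evalHermitian]

theorem integral_gaussWeight_pos (hN : 1 ≤ N) : 0 < ∫ H, gaussWeight N H ∂μ := by
  have h := (integrable_evalHermitian_mul_gaussWeight μ hN 1).re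
  simp only [evalHermitian, map_one, one_mul, RCLike.re_to_complex, Complex.ofReal_re] at h
  exact integral_exp_pos h

/-- The derivation of the polynomial ring in the matrix entries in the direction `V`. -/
noncomputable def entryDerivation (V : Matrix (Fin N) (Fin N) ℂ) :
    Derivation ℂ (MvPolynomial (Fin N × Fin N) ℂ) (MvPolynomial (Fin N × Fin N) ℂ) :=
  MvPolynomial.mkDerivation ℂ fun ij => MvPolynomial.C (V ij.1 ij.2)

theorem entryDerivation_add (V W : Matrix (Fin N) (Fin N) ℂ) :
    entryDerivation (V + W) = entryDerivation V + entryDerivation W :=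
  MvPolynomial.derivation_ext fun ij => by
    simp [entryDerivation, MvPolynomial.mkDerivation_X]

theorem entryDerivation_smul (a : ℂ) (V : Matrix (Fin N) (Fin N) ℂ) :
    entryDerivation (a • V) = a • entryDerivation V :=
  MvPolynomial.derivation_ext fun ij => by
    simp [entryDerivation, MvPolynomial.mkDerivation_X, MvPolynomial.smul_eq_C_mul]

theorem entryDerivation_single (i j : Fin N) :
    entryDerivation (Matrix.single i j 1) = MvPolynomial.pderiv (R := ℂ) (i, j) :=
  MvPolynomial.derivation_ext fun ij => by
    rw [entryDerivation, MvPolynomial.mkDerivation_X, MvPolynomial.pderiv_X, Pi.single_apply,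
      Matrix.single_apply]
    split_ifs <;> simp_all [Prod.ext_iff]

theorem hasLineDerivAt_evalHermitian (p : MvPolynomial (Fin N × Fin N) ℂ)
    (H V : selfAdjoint (Matrix (Fin N) (Fin N) ℂ)) :
    HasLineDerivAt ℝ (evalHermitian p) (evalHermitian (entryDerivation V p) H) H V := by
  induction p using MvPolynomial.induction_on with
  | C a =>
    simpa [HasLineDerivAt, evalHermitian, entryDerivation] using hasDerivAt_const (0 : ℝ) a
  | add p q hp hq =>
    refine (HasDerivAt.add hp hq).congr_deriv ?_ |>.congr_of_eventuallyEq (.of_forall fun t => ?_)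
    · simp [evalHermitian]
    · simp [evalHermitian]
  | mul_X p ij hp =>
    have hX : HasDerivAt (fun t : ℝ => evalHermitian (MvPolynomial.X ij) (H + t • V))
        ((V : Matrix (Fin N) (Fin N) ℂ) ij.1 ij.2) 0 := by
      have := ((hasDerivAt_id (0 : ℝ)).ofReal_comp.mul_const
        ((V : Matrix (Fin N) (Fin N) ℂ) ij.1 ij.2)).const_add
        ((H : Matrix (Fin N) (Fin N) ℂ) ij.1 ij.2)
      simpa [evalHermitian] using this
    have := HasDerivAt.mul hp hX
    simp only [HasLineDerivAt]
    refine (this.congr_deriv ?_).congr_of_eventuallyEq (.of_forall fun t => ?_)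
    · simp [evalHermitian, entryDerivation, MvPolynomial.mkDerivation_X]
      ring
    · simp [evalHermitian]

/-- The quadratic potential `(N / 2) tr X ^ 2 + (1 / 2) (tr X) ^ 2` of the ensemble. -/
noncomputable def diracPotential (N : ℕ) : MvPolynomial (Fin N × Fin N) ℂ :=
  MvPolynomial.C (N / 2 : ℂ) * genericTracePow (Fin N) ℂ 2 +
    MvPolynomial.C (1 / 2 : ℂ) * genericTracePow (Fin N) ℂ 1 ^ 2

theorem pderiv_diracPotential (i j : Fin N) :
    MvPolynomial.pderiv (i, j) (diracPotential N) =
      N * mvPolynomialX (Fin N) (Fin N) ℂ j i +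
        (1 : Matrix (Fin N) (Fin N) (MvPolynomial (Fin N × Fin N) ℂ)) i j *
          genericTracePow (Fin N) ℂ 1 := by
  have h2 : (MvPolynomial.C (N / 2) : MvPolynomial (Fin N × Fin N) ℂ) * 2 = N := by
    rw [← map_ofNat MvPolynomial.C 2, ← map_mul]
    simp
  have h1 : (MvPolynomial.C (1 / 2) : MvPolynomial (Fin N × Fin N) ℂ) * 2 = 1 := by
    rw [← map_ofNat MvPolynomial.C 2, ← map_mul]
    simp
  have hsymm : (1 : Matrix (Fin N) (Fin N) (MvPolynomial (Fin N × Fin N) ℂ)) j i =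
      (1 : Matrix (Fin N) (Fin N) (MvPolynomial (Fin N × Fin N) ℂ)) i j := by
    simp [Matrix.one_apply, eq_comm]
  rw [diracPotential, map_add, MvPolynomial.pderiv_C_mul, MvPolynomial.pderiv_C_mul,
    MvPolynomial.pderiv_pow, pderiv_genericTracePow, pderiv_genericTracePow]
  simp only [Nat.add_one_sub_one, pow_one, Nat.sub_self, pow_zero, hsymm, Nat.cast_ofNat,
    Nat.cast_one, one_mul]
  linear_combination mvPolynomialX (Fin N) (Fin N) ℂ j i * h2 +
    (1 : Matrix (Fin N) (Fin N) (MvPolynomial (Fin N × Fin N) ℂ)) i j *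
          genericTracePow (Fin N) ℂ 1 * h1

theorem ofReal_gaussWeight (H : selfAdjoint (Matrix (Fin N) (Fin N) ℂ)) :
    (gaussWeight N H : ℂ) = Complex.exp (-evalHermitian (diracPotential N) H) := by
  have h1 : ((Matrix.trace (H : Matrix (Fin N) (Fin N) ℂ)).re : ℂ) =
      Matrix.trace (H : Matrix (Fin N) (Fin N) ℂ) := by
    rw [← Complex.conj_eq_iff_re]
    have := Matrix.trace_conjTranspose (H : Matrix (Fin N) (Fin N) ℂ)
    rw [← Matrix.star_eq_conjTranspose, selfAdjoint.star_val_eq] at this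
    exact this.symm
  have h2 : ((Matrix.trace ((H : Matrix (Fin N) (Fin N) ℂ) ^ 2)).re : ℂ) =
      Matrix.trace ((H : Matrix (Fin N) (Fin N) ℂ) ^ 2) := by
    rw [trace_sq_eq_sum_norm_sq, Complex.ofReal_re]
  have heval : evalHermitian (diracPotential N) H =
      N / 2 * Matrix.trace ((H : Matrix (Fin N) (Fin N) ℂ) ^ 2) +
        1 / 2 * Matrix.trace (H : Matrix (Fin N) (Fin N) ℂ) ^ 2 := by
    have e1 := evalHermitian_genericTracePow 1 H
    have e2 := evalHermitian_genericTracePow 2 H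
    rw [pow_one] at e1
    rw [← e1, ← e2]
    simp [evalHermitian, diracPotential]
  rw [gaussWeight, Complex.ofReal_exp, heval]
  push_cast
  rw [h1, h2]
  ring_nf

theorem hasLineDerivAt_gaussWeight (H V : selfAdjoint (Matrix (Fin N) (Fin N) ℂ)) :
    HasLineDerivAt ℝ (fun H => (gaussWeight N H : ℂ))
      (-(evalHermitian (entryDerivation V (diracPotential N)) H * gaussWeight N H)) H V := by
  have := (hasLineDerivAt_evalHermitian (diracPotential N) H V)
  simp only [HasLineDerivAt, ofReal_gaussWeight] at this ⊢
  refine this.neg.cexp.congr_deriv ?_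
  simp
  ring

theorem gaussFunctional_entryDerivation_of_selfAdjoint (hN : 1 ≤ N)
    (V : selfAdjoint (Matrix (Fin N) (Fin N) ℂ)) (p : MvPolynomial (Fin N × Fin N) ℂ) :
    gaussFunctional μ hN (entryDerivation V p) =
      gaussFunctional μ hN (p * entryDerivation V (diracPotential N)) := by
  have hmul : ∀ H, evalHermitian p H *
      -(evalHermitian (entryDerivation V (diracPotential N)) H * (gaussWeight N H : ℂ)) =
      -(evalHermitian (p * entryDerivation V (diracPotential N)) H * (gaussWeight N H : ℂ)) :=
    fun H => by
      simp only [evalHermitian, map_mul]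
      ring
  have h := integral_bilinear_hasLineDerivAt_right_eq_neg_left_of_integrable (μ := μ)
    (B := ContinuousLinearMap.mul ℝ ℂ) (f := evalHermitian p)
    (f' := evalHermitian (entryDerivation V p)) (g := fun H => (gaussWeight N H : ℂ))
    (g' := fun H =>
      -(evalHermitian (entryDerivation V (diracPotential N)) H * gaussWeight N H)) (v := V)
    (integrable_evalHermitian_mul_gaussWeight μ hN _)
    (by
      simp only [ContinuousLinearMap.mul_apply', hmul]
      exact (integrable_evalHermitian_mul_gaussWeight μ hN _).neg)
    (integrable_evalHermitian_mul_gaussWeight μ hN _)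
    (fun H _ => hasLineDerivAt_evalHermitian p H V)
    (fun H _ => hasLineDerivAt_gaussWeight H V)
  simp only [ContinuousLinearMap.mul_apply', hmul, integral_neg, neg_inj] at h
  exact h.symm

theorem gaussFunctional_entryDerivation (hN : 1 ≤ N) (V : Matrix (Fin N) (Fin N) ℂ)
    (p : MvPolynomial (Fin N × Fin N) ℂ) :
    gaussFunctional μ hN (entryDerivation V p) =
      gaussFunctional μ hN (p * entryDerivation V (diracPotential N)) := by
  rw [← realPart_add_I_smul_imaginaryPart V]
  simp only [entryDerivation_add, entryDerivation_smul, Derivation.add_apply,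
    Derivation.smul_apply, mul_add, mul_smul_comm, map_add, map_smul,
    gaussFunctional_entryDerivation_of_selfAdjoint]

theorem gaussFunctional_pderiv (hN : 1 ≤ N) (i j : Fin N) (p : MvPolynomial (Fin N × Fin N) ℂ) :
    gaussFunctional μ hN (MvPolynomial.pderiv (i, j) p) =
      gaussFunctional μ hN (p * (N * mvPolynomialX (Fin N) (Fin N) ℂ j i +
        (1 : Matrix (Fin N) (Fin N) (MvPolynomial (Fin N × Fin N) ℂ)) i j *
          genericTracePow (Fin N) ℂ 1)) := by
  rw [← entryDerivation_single, gaussFunctional_entryDerivation, entryDerivation_single,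
    pderiv_diracPotential]

end GaussianIntegral

section Limit

theorem trace_diracOp_pow {N : ℕ} (H : selfAdjoint (Matrix (Fin N) (Fin N) ℂ)) (m : ℕ) :
    Matrix.trace (diracOp N H ^ m) = ∑ k ∈ Finset.range (m + 1),
      Matrix.trace ((H : Matrix (Fin N) (Fin N) ℂ) ^ k) *
        Matrix.trace ((H : Matrix (Fin N) (Fin N) ℂ) ^ (m - k)) * m.choose k := by
  set A := (H : Matrix (Fin N) (Fin N) ℂ)
  have hleft : ∀ k, (A ⊗ₖ (1 : Matrix (Fin N) (Fin N) ℂ)) ^ k = (A ^ k) ⊗ₖ 1 := fun k => by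
    induction k with
    | zero => simp
    | succ k ih => rw [pow_succ, ih, ← Matrix.mul_kronecker_mul, one_mul, pow_succ]
  have hright : ∀ k, ((1 : Matrix (Fin N) (Fin N) ℂ) ⊗ₖ Aᵀ) ^ k = 1 ⊗ₖ (A ^ k)ᵀ := fun k => by
    induction k with
    | zero => simp
    | succ k ih =>
      rw [pow_succ, ih, ← Matrix.mul_kronecker_mul, one_mul, pow_succ', Matrix.transpose_mul]
  have hcomm : Commute (A ⊗ₖ (1 : Matrix (Fin N) (Fin N) ℂ)) (1 ⊗ₖ Aᵀ) := by
    rw [Commute, SemiconjBy, ← Matrix.mul_kronecker_mul, ← Matrix.mul_kronecker_mul]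
    simp only [one_mul, mul_one]
  rw [diracOp, hcomm.add_pow, Matrix.trace_sum]
  refine Finset.sum_congr rfl fun k _ => ?_
  rw [hleft, hright, ← Matrix.mul_kronecker_mul, one_mul, mul_one, ← nsmul_eq_mul',
    Matrix.trace_smul, Matrix.trace_kronecker, Matrix.trace_transpose, nsmul_eq_mul']

/-- The normalised mixed trace moments `⟨∏ (1 / N) tr H ^ l⟩` of the ensemble. -/
noncomputable def mixedTraceMoment
    (lam : ∀ N : ℕ, Measure (selfAdjoint (Matrix (Fin N) (Fin N) ℂ))) (N : ℕ) (L : Multiset ℕ) : ℂ :=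
  (∫ H, evalHermitian (genericTraceProd (Fin N) ℂ L) H * (gaussWeight N H : ℂ) ∂(lam N)) /
    (((∫ H, gaussWeight N H ∂(lam N) : ℝ) : ℂ) * (N : ℂ) ^ L.card)

theorem gaussFunctional_genericTraceProd
    (lam : ∀ N : ℕ, Measure (selfAdjoint (Matrix (Fin N) (Fin N) ℂ))) {N : ℕ} (hN : 1 ≤ N)
    [(lam N).IsAddHaarMeasure] (L : Multiset ℕ) :
    gaussFunctional (lam N) hN (genericTraceProd (Fin N) ℂ L) =
      mixedTraceMoment lam N L * (((∫ H, gaussWeight N H ∂(lam N) : ℝ) : ℂ) * (N : ℂ) ^ L.card) := by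
  have hZ : ((∫ H, gaussWeight N H ∂(lam N) : ℝ) : ℂ) ≠ 0 :=
    Complex.ofReal_ne_zero.2 (integral_gaussWeight_pos (lam N) hN).ne'
  have hN0 : (N : ℂ) ≠ 0 := by exact_mod_cast (by omega : N ≠ 0)
  rw [mixedTraceMoment, div_mul_cancel₀ _ (mul_ne_zero hZ (pow_ne_zero _ hN0))]
  rfl

theorem tendsto_mixedTraceMoment
    (lam : ∀ N : ℕ, Measure (selfAdjoint (Matrix (Fin N) (Fin N) ℂ)))
    (hlam : ∀ N : ℕ, 1 ≤ N → (lam N).IsAddHaarMeasure) (L : Multiset ℕ) :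
    Tendsto (fun N => mixedTraceMoment lam N L) atTop
      (nhds (L.map fun k => (semicircleMoment k : ℂ)).prod) := by
  have hZ : ∀ N, 1 ≤ N → ((∫ H, gaussWeight N H ∂(lam N) : ℝ) : ℂ) ≠ 0 := fun N hN => by
    have := hlam N hN
    exact Complex.ofReal_ne_zero.2 (integral_gaussWeight_pos (lam N) hN).ne'
  have hN0 : ∀ N : ℕ, 1 ≤ N → (N : ℂ) ≠ 0 := fun N hN => by
    exact_mod_cast (by omega : N ≠ 0)
  refine tendsto_of_loop_equation (fun k => (semicircleMoment k : ℂ)) (by simp [semicircleMoment])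
    (fun k => by rw [semicircleMoment_succ]; push_cast; rfl) (mixedTraceMoment lam) ?_ ?_ ?_ L
  · filter_upwards [eventually_ge_atTop 1] with N hN
    have := hlam N hN
    refine mul_right_cancel₀ (hZ N hN) ?_
    have h := gaussFunctional_genericTraceProd lam hN 0
    rw [Multiset.card_zero, pow_zero, mul_one] at h
    rw [← h, one_mul, ← gaussFunctional_one (lam N) hN]
    simp [genericTraceProd]
  · filter_upwards [eventually_ge_atTop 1] with N hN L
    have := hlam N hN
    refine mul_right_cancel₀ (mul_ne_zero (hZ N hN) (pow_ne_zero (L.card + 1) (hN0 N hN))) ?_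
    have h := gaussFunctional_genericTraceProd lam hN (0 ::ₘ L)
    rw [Multiset.card_cons] at h
    rw [← h, genericTraceProd_cons, genericTracePow_zero, Fintype.card_fin, ← nsmul_eq_mul,
      map_nsmul, gaussFunctional_genericTraceProd, nsmul_eq_mul]
    ring
  · filter_upwards [eventually_ge_atTop 1] with N hN k L
    have := hlam N hN
    have h := loop_equation (gaussFunctional (lam N) hN)
      (fun i j p => by rw [Fintype.card_fin]; exact gaussFunctional_pderiv (lam N) hN i j p) k L
    have hsum : (L.map fun l : ℕ => (l : ℂ) * gaussFunctional (lam N) hN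
        (genericTraceProd (Fin N) ℂ ((k + (l - 1)) ::ₘ L.erase l))).sum =
        (L.map fun l : ℕ => (l : ℂ) * mixedTraceMoment lam N ((k + (l - 1)) ::ₘ L.erase l)).sum *
          (((∫ H, gaussWeight N H ∂(lam N) : ℝ) : ℂ) * (N : ℂ) ^ L.card) := by
      rw [← Multiset.sum_map_mul_right]
      refine congrArg Multiset.sum (Multiset.map_congr rfl fun l hl => ?_)
      rw [gaussFunctional_genericTraceProd, Multiset.card_cons, Multiset.card_erase_add_one hl,
        mul_assoc]
    rw [hsum] at h
    simp only [gaussFunctional_genericTraceProd, Multiset.card_cons, Fintype.card_fin,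
      ← Finset.sum_mul] at h
    refine mul_right_cancel₀ (mul_ne_zero (hZ N hN) (pow_ne_zero (L.card + 2) (hN0 N hN))) ?_
    have h0 := hN0 N hN
    set S := (L.map fun l : ℕ => (l : ℂ) *
      mixedTraceMoment lam N ((k + (l - 1)) ::ₘ L.erase l)).sum
    have hpow : ((N : ℂ) ^ 2)⁻¹ * (N : ℂ) ^ (L.card + 2) = (N : ℂ) ^ L.card := by
      field_simp
      ring
    linear_combination h - ((∫ H, gaussWeight N H ∂(lam N) : ℝ) : ℂ) * S * hpow

theorem normalized_trace_diracOp_eq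
    (lam : ∀ N : ℕ, Measure (selfAdjoint (Matrix (Fin N) (Fin N) ℂ))) {N : ℕ} (hN : 1 ≤ N)
    [(lam N).IsAddHaarMeasure] (m : ℕ) :
    (1 / (N : ℝ) ^ 2) * ((∫ H, (Matrix.trace ((diracOp N H) ^ m)).re * gaussWeight N H ∂(lam N)) /
      (∫ H, gaussWeight N H ∂(lam N))) =
    (∑ k ∈ Finset.range (m + 1), mixedTraceMoment lam N {k, m - k} * m.choose k).re := by
  have hint := fun k => integrable_evalHermitian_mul_gaussWeight (lam N) hN
    (genericTraceProd (Fin N) ℂ {k, m - k})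
  have htrace : ∀ H, (Matrix.trace ((diracOp N H) ^ m)).re * gaussWeight N H =
      (∑ k ∈ Finset.range (m + 1), evalHermitian (genericTraceProd (Fin N) ℂ {k, m - k}) H *
        (gaussWeight N H : ℂ) * m.choose k).re := fun H => by
    rw [← Complex.re_mul_ofReal, trace_diracOp_pow, Finset.sum_mul]
    congr 1
    refine Finset.sum_congr rfl fun k _ => ?_
    have : evalHermitian (genericTraceProd (Fin N) ℂ {k, m - k}) H =
        evalHermitian (genericTracePow (Fin N) ℂ k) H *
          evalHermitian (genericTracePow (Fin N) ℂ (m - k)) H := by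
      simp [genericTraceProd, evalHermitian]
    rw [this, evalHermitian_genericTracePow, evalHermitian_genericTracePow]
    ring
  have hre := integral_re (μ := lam N)
    (integrable_finsetSum (Finset.range (m + 1)) fun k _ => (hint k).mul_const (m.choose k : ℂ))
  simp only [RCLike.re_to_complex] at hre
  simp_rw [htrace]
  rw [hre, integral_finsetSum _ fun k _ => (hint k).mul_const (m.choose k : ℂ), one_div_mul_eq_div,
    div_div, ← Complex.div_ofReal_re, Finset.sum_div]
  congr 1
  refine Finset.sum_congr rfl fun k _ => ?_
  rw [integral_mul_const, mixedTraceMoment]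
  push_cast
  simp only [Multiset.insert_eq_cons, Multiset.card_cons, Multiset.card_singleton]
  ring

end Limit

/-- The limiting spectral moments of the type (1,0) Gaussian Dirac ensemble are those
of the self-convolution of the Wigner semicircle distribution. -/
theorem gaussian_dirac_ensemble_wigner_convolution_law
    (lam : ∀ N : ℕ, Measure (selfAdjoint (Matrix (Fin N) (Fin N) ℂ)))
    (hlam : ∀ N : ℕ, 1 ≤ N → (lam N).IsAddHaarMeasure) (m : ℕ) :
    Tendsto (fun N : ℕ =>
        (1 / (N : ℝ) ^ 2) *
          ((∫ H, (Matrix.trace ((diracOp N H) ^ m)).re * gaussWeight N H ∂(lam N)) /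
            (∫ H, gaussWeight N H ∂(lam N))))
      atTop (nhds (∫ x : ℝ, x ^ m * rhoD x)) := by
  have hlim : Tendsto (fun N => ∑ k ∈ Finset.range (m + 1),
      mixedTraceMoment lam N {k, m - k} * m.choose k) atTop
      (nhds ((∫ x : ℝ, x ^ m * rhoD x : ℝ) : ℂ)) := by
    rw [integral_pow_mul_rhoD]
    push_cast
    refine tendsto_finsetSum _ fun k _ => Tendsto.mul_const _ ?_
    simpa using tendsto_mixedTraceMoment lam hlam {k, m - k}
  refine ((Complex.continuous_re.tendsto _).comp hlim).congr' ?_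
  filter_upwards [eventually_ge_atTop 1] with N hN
  have := hlam N hN
  exact (normalized_trace_diracOp_eq lam hN m).symm
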